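/- (Fundamental lemma.) Let T be a positive integer, let w ∈ B_T, and let L ∈ {1,…,T} with L > ℓ. Then the column span of the Hankel matrix H_L(w) equals B_L if and only if rank H_L(w) = mL + n. -/

import Mathlib

/-!
STATEMENT 4: The fundamental lemma (Willems et al.): the column span of the\nHankel matrix H_L(w) equals the restricted behavior B_L iff rank H_L(w) = mL + n.
-/

open Filter Topology

noncomputable section FL

/-- The `k`-step observability matrix col(C, CA, …, CA^(k−1)). -/
def obsvMat (n p k : ℕ) (A : Matrix (Fin n) (Fin n) ℝ) (C : Matrix (Fin p) (Fin n) ℝ) :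
    Matrix (Fin k × Fin p) (Fin n) ℝ :=
  fun r j => (C * A ^ (r.1 : ℕ)) r.2 j

/-- The controllability matrix [B, AB, …, A^(n−1)B]. -/
def ctrbMat (n m : ℕ) (A : Matrix (Fin n) (Fin n) ℝ) (B : Matrix (Fin n) (Fin m) ℝ) :
    Matrix (Fin n) (Fin n × Fin m) ℝ :=
  fun i c => (A ^ (c.1 : ℕ) * B) i c.2

/-- The restricted behavior B_L over the horizon L: stacked input/output
trajectories w, with w(t) = col(u(t), y(t)) ∈ ℝ^(m+p), generated by the
state-space representation (A, B, C, D). A stacked vector in ℝ^(qL), q = m + p,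
is identified with a function `Fin L × (Fin m ⊕ Fin p) → ℝ`. -/
def behavior (m n p L : ℕ) (A : Matrix (Fin n) (Fin n) ℝ) (B : Matrix (Fin n) (Fin m) ℝ)
    (C : Matrix (Fin p) (Fin n) ℝ) (D : Matrix (Fin p) (Fin m) ℝ) :
    Set (Fin L × (Fin m ⊕ Fin p) → ℝ) :=
  {w | ∃ x : Fin (L + 1) → Fin n → ℝ, ∀ t : Fin L,
    x t.succ = A.mulVec (x t.castSucc) + B.mulVec (fun i => w (t, Sum.inl i)) ∧
    (fun j => w (t, Sum.inr j)) =
      C.mulVec (x t.castSucc) + D.mulVec (fun i => w (t, Sum.inl i))}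

/-- The Hankel matrix of depth L associated with w ∈ ℝ^(qT): its j-th block
column is col(w(j), w(j+1), …, w(j+L−1)). -/
def hankel (m p T L : ℕ) (hLT : L ≤ T) (w : Fin T × (Fin m ⊕ Fin p) → ℝ) :
    Matrix (Fin L × (Fin m ⊕ Fin p)) (Fin (T - L + 1)) ℝ :=
  fun r j => w (⟨(j : ℕ) + (r.1 : ℕ), by
    have h1 := j.isLt
    have h2 := r.1.isLt
    omega⟩, r.2)

/-- The input at time `t`, extended by zero beyond the horizon, as a linear function of the
initial state and the input sequence. -/
def inputMap (m n L t : ℕ) :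
    ((Fin n → ℝ) × (Fin L × Fin m → ℝ)) →ₗ[ℝ] (Fin m → ℝ) :=
  if h : t < L then
    LinearMap.pi fun i => LinearMap.proj (⟨t, h⟩, i) ∘ₗ LinearMap.snd ℝ _ _
  else 0

lemma inputMap_apply (m n L : ℕ) (t : Fin L) (z : (Fin n → ℝ) × (Fin L × Fin m → ℝ)) :
    inputMap m n L t z = fun i => z.2 (t, i) := by
  ext i
  simp [inputMap]

/-- The state at time `t` as a linear function of the initial state and the input sequence. -/
def stateMap (m n L : ℕ) (A : Matrix (Fin n) (Fin n) ℝ) (B : Matrix (Fin n) (Fin m) ℝ) :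
    ℕ → ((Fin n → ℝ) × (Fin L × Fin m → ℝ)) →ₗ[ℝ] (Fin n → ℝ)
  | 0 => LinearMap.fst ℝ _ _
  | t + 1 => A.mulVecLin ∘ₗ stateMap m n L A B t + B.mulVecLin ∘ₗ inputMap m n L t

/-- The trajectory generated by an initial state and an input sequence. -/
def trajMap (m n p L : ℕ) (A : Matrix (Fin n) (Fin n) ℝ) (B : Matrix (Fin n) (Fin m) ℝ)
    (C : Matrix (Fin p) (Fin n) ℝ) (D : Matrix (Fin p) (Fin m) ℝ) :
    ((Fin n → ℝ) × (Fin L × Fin m → ℝ)) →ₗ[ℝ] (Fin L × (Fin m ⊕ Fin p) → ℝ) :=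
  LinearMap.pi fun r => Sum.elim
    (fun i => LinearMap.proj i ∘ₗ inputMap m n L r.1)
    (fun j => LinearMap.proj j ∘ₗ
      (C.mulVecLin ∘ₗ stateMap m n L A B r.1 + D.mulVecLin ∘ₗ inputMap m n L r.1)) r.2

section

variable {m n p L : ℕ} {A : Matrix (Fin n) (Fin n) ℝ} {B : Matrix (Fin n) (Fin m) ℝ}
  {C : Matrix (Fin p) (Fin n) ℝ} {D : Matrix (Fin p) (Fin m) ℝ}

lemma trajMap_inl (z : (Fin n → ℝ) × (Fin L × Fin m → ℝ)) (t : Fin L) (i : Fin m) :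
    trajMap m n p L A B C D z (t, Sum.inl i) = z.2 (t, i) := by
  simp [trajMap, inputMap_apply]

lemma trajMap_inr (z : (Fin n → ℝ) × (Fin L × Fin m → ℝ)) (t : Fin L) (j : Fin p) :
    trajMap m n p L A B C D z (t, Sum.inr j) =
      (C.mulVec (stateMap m n L A B t z) + D.mulVec (fun i => z.2 (t, i))) j := by
  simp [trajMap, inputMap_apply]

lemma stateMap_succ (z : (Fin n → ℝ) × (Fin L × Fin m → ℝ)) (t : Fin L) :
    stateMap m n L A B (t + 1) z =
      A.mulVec (stateMap m n L A B t z) + B.mulVec (fun i => z.2 (t, i)) := by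
  simp [stateMap, inputMap_apply]

/-- A sequence obeying the state equation is determined by its initial value and the input. -/
lemma eq_stateMap (x : Fin (L + 1) → Fin n → ℝ) (u : Fin L × Fin m → ℝ)
    (hx : ∀ t : Fin L, x t.succ = A.mulVec (x t.castSucc) + B.mulVec (fun i => u (t, i)))
    (t : Fin (L + 1)) : x t = stateMap m n L A B t (x 0, u) := by
  induction t using Fin.induction with
  | zero => simp [stateMap]
  | succ t ih => rw [hx, ih, Fin.val_succ, stateMap_succ, Fin.val_castSucc]

lemma range_trajMap : (LinearMap.range (trajMap m n p L A B C D) :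
    Set (Fin L × (Fin m ⊕ Fin p) → ℝ)) = behavior m n p L A B C D := by
  ext v
  constructor
  · rintro ⟨z, rfl⟩
    refine ⟨fun t => stateMap m n L A B t z, fun t => ⟨?_, ?_⟩⟩
    · simp only [trajMap_inl]
      exact stateMap_succ z t
    · ext j
      simp only [trajMap_inl, trajMap_inr, Fin.val_castSucc]
  · rintro ⟨x, hx⟩
    refine ⟨(x 0, fun r => v (r.1, Sum.inl r.2)), ?_⟩
    ext ⟨t, i | j⟩
    · rw [trajMap_inl]
    · have h := eq_stateMap x (fun r => v (r.1, Sum.inl r.2)) (fun s => (hx s).1) t.castSucc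
      rw [trajMap_inr, congrFun (hx t).2 j, h, Fin.val_castSucc]

lemma stateMap_zero_input (x : Fin n → ℝ) (t : ℕ) :
    stateMap m n L A B t (x, 0) = (A ^ t).mulVec x := by
  induction t with
  | zero => simp [stateMap]
  | succ t ih =>
    have h : inputMap m n L t (x, 0) = 0 := by
      unfold inputMap
      split_ifs <;> rfl
    simp [stateMap, ih, h, pow_succ']

lemma mulVec_injective_of_rank_eq {ι : Type*} [Fintype ι] (M : Matrix ι (Fin n) ℝ)
    (hM : M.rank = n) : Function.Injective M.mulVecLin := by
  rw [← LinearMap.ker_eq_bot, ← Submodule.finrank_eq_zero (R := ℝ)]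
  have h := M.mulVecLin.finrank_range_add_finrank_ker
  rw [← Matrix.rank, hM, Module.finrank_fin_fun] at h
  omega

lemma trajMap_injective {k : ℕ} (hkL : k ≤ L) (hk : (obsvMat n p k A C).rank = n) :
    Function.Injective (trajMap m n p L A B C D) := by
  rw [← LinearMap.ker_eq_bot, LinearMap.ker_eq_bot']
  rintro ⟨x, u⟩ h
  obtain rfl : u = 0 := by
    ext ⟨t, i⟩
    simpa only [trajMap_inl, Pi.zero_apply] using congrFun h (t, Sum.inl i)
  have hx : x = 0 := by
    refine mulVec_injective_of_rank_eq _ hk ?_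
    rw [map_zero]
    ext ⟨t, j⟩
    have hj := congrFun h (⟨t, t.isLt.trans_le hkL⟩, Sum.inr j)
    have hz : (fun _ : Fin m => (0 : ℝ)) = 0 := rfl
    simp only [trajMap_inr, stateMap_zero_input, Matrix.mulVec_mulVec, Pi.zero_apply, hz,
      Matrix.mulVec_zero, add_zero] at hj
    exact hj
  rw [hx]
  rfl

lemma finrank_range_trajMap {k : ℕ} (hkL : k ≤ L) (hk : (obsvMat n p k A C).rank = n) :
    Module.finrank ℝ (LinearMap.range (trajMap m n p L A B C D)) = m * L + n := by
  rw [LinearMap.finrank_range_of_inj (trajMap_injective hkL hk)]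
  simp [Module.finrank_prod, Module.finrank_fintype_fun_eq_card]
  ring

lemma hankel_col_mem_behavior {T : ℕ} {w : Fin T × (Fin m ⊕ Fin p) → ℝ}
    (hw : w ∈ behavior m n p T A B C D) (hLT : L ≤ T) (j : Fin (T - L + 1)) :
    (hankel m p T L hLT w).col j ∈ behavior m n p L A B C D := by
  obtain ⟨x, hx⟩ := hw
  refine ⟨fun t => x ⟨j + t, by omega⟩, fun t => ?_⟩
  exact hx ⟨j + t, by omega⟩

lemma range_hankel_le {T : ℕ} {w : Fin T × (Fin m ⊕ Fin p) → ℝ}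
    (hw : w ∈ behavior m n p T A B C D) (hLT : L ≤ T) :
    LinearMap.range (hankel m p T L hLT w).mulVecLin ≤
      LinearMap.range (trajMap m n p L A B C D) := by
  rw [Matrix.range_mulVecLin, Submodule.span_le, range_trajMap]
  rintro _ ⟨j, rfl⟩
  exact hankel_col_mem_behavior hw hLT j

end

theorem statement4
    (m n p : ℕ) (hm : 0 < m) (hn : 0 < n) (hp : 0 < p)
    (A : Matrix (Fin n) (Fin n) ℝ) (B : Matrix (Fin n) (Fin m) ℝ)
    (C : Matrix (Fin p) (Fin n) ℝ) (D : Matrix (Fin p) (Fin m) ℝ)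
    -- (A,B) controllable and (A,C) observable (minimality)
    (hctrb : (ctrbMat n m A B).rank = n)
    (hobsv : (obsvMat n p n A C).rank = n)
    -- ℓ is the lag: the least positive k with rank col(C, …, CA^(k−1)) = n
    (ℓ : ℕ) (hlag : IsLeast {k : ℕ | 0 < k ∧ (obsvMat n p k A C).rank = n} ℓ)
    -- data: w ∈ B_T
    (T : ℕ) (hT : 0 < T) (w : Fin T × (Fin m ⊕ Fin p) → ℝ)
    (hw : w ∈ behavior m n p T A B C D)
    -- horizon L ∈ {1, …, T} with L > ℓ
    (L : ℕ) (hL1 : 1 ≤ L) (hLT : L ≤ T) (hLl : ℓ < L) :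
    -- the column span of H_L(w) equals B_L iff rank H_L(w) = mL + n
    ({v | ∃ g : Fin (T - L + 1) → ℝ, v = (hankel m p T L hLT w).mulVec g} =
        behavior m n p L A B C D) ↔
      (hankel m p T L hLT w).rank = m * L + n := by
  have hset : {v | ∃ g : Fin (T - L + 1) → ℝ, v = (hankel m p T L hLT w).mulVec g} =
      (LinearMap.range (hankel m p T L hLT w).mulVecLin : Set _) := by
    ext v
    simp [eq_comm]
  rw [hset, ← range_trajMap, SetLike.coe_set_eq, Matrix.rank,
    ← finrank_range_trajMap (B := B) (D := D) hLl.le hlag.1.2]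
  exact ⟨fun h => by rw [h], Submodule.eq_of_le_of_finrank_eq (range_hankel_le hw hLT)⟩

end FL
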